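/- There exist unsplittable transshipment instances with unit arc capacities and integral supplies and demands such that deciding existence of a feasible unsplittable transshipment is equivalent to the arc-disjoint paths problem: given a digraph D and pairs (s^i, t^i) for i = 1,…,k, adding arcs (s^i, t^j) for all i ≠ j and setting b(s^i) = k, b(t^i) = −k produces an instance that admits a feasible unsplittable transshipment if and only if D contains pairwise arc-disjoint s^i–t^i paths for i = 1,…,k. -/

import Mathlib

/-- `DiPath tl hd u v l`: the nonempty list of arcs `l` forms a directed path
from `u` to `v` (consecutive arcs are chained head-to-tail). -/
def DiPath {V α : Type*} (tl hd : α → V) (u v : V) (l : List α) : Prop :=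
  ∃ hne : l ≠ [],
    tl (l.head hne) = u ∧ hd (l.getLast hne) = v ∧
    l.Chain' (fun a a' => hd a = tl a')

def WalkAux {V α : Type*} (tl hd : α → V) : V → V → List α → Prop
  | u, v, [] => u = v
  | u, v, a :: l => tl a = u ∧ WalkAux tl hd (hd a) v l

theorem diPath_iff {V α : Type*} (tl hd : α → V) (u v : V) (l : List α) :
    DiPath tl hd u v l ↔ l ≠ [] ∧ WalkAux tl hd u v l := by
  induction l generalizing u with
  | nil => simp [DiPath]
  | cons a l ih =>
    cases l with
    | nil =>
      simp only [DiPath, List.Chain']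
      simp [WalkAux]
    | cons b l =>
      have h := ih (hd a)
      simp only [DiPath, List.Chain', WalkAux, ne_eq, reduceCtorEq, not_false_eq_true, List.head_cons,
        exists_true_left, true_and, List.isChain_cons_cons, List.getLast_cons_cons] at h ⊢
      rw [← h]
      constructor
      · rintro ⟨h1, h2, h3, h4⟩
        exact ⟨h1, h3.symm, h2, h4⟩
      · rintro ⟨h1, h3, h2, h4⟩
        exact ⟨h1, h2, h3.symm, h4⟩

theorem walkAux_append {V α : Type*} (tl hd : α → V) (u v : V) (l m : List α) :
    WalkAux tl hd u v (l ++ m) ↔ ∃ w, WalkAux tl hd u w l ∧ WalkAux tl hd w v m := by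
  induction l generalizing u with
  | nil => simp [WalkAux]
  | cons a l ih => simp [WalkAux, ih, and_assoc]

theorem walkAux_map {V α β : Type*} (tl hd : α → V) (tl' hd' : β → V) (f : α → β)
    (h1 : ∀ a, tl' (f a) = tl a) (h2 : ∀ a, hd' (f a) = hd a) (u v : V) (l : List α) :
    WalkAux tl' hd' u v (l.map f) ↔ WalkAux tl hd u v l := by
  induction l generalizing u with
  | nil => simp [WalkAux]
  | cons a l ih => simp [WalkAux, ih, h1, h2]

theorem exists_nodup_walk {V α : Type*} (tl hd : α → V) (v : V) (l : List α) :
    ∀ u, WalkAux tl hd u v l → l ≠ [] →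
      ∃ m : List α, m ≠ [] ∧ WalkAux tl hd u v m ∧ m.Nodup ∧ ∀ a ∈ m, a ∈ l := by
  classical
  induction l with
  | nil => intro u _ h; exact absurd rfl h
  | cons a l ih =>
    intro u hw _
    obtain ⟨h1, h2⟩ := hw
    by_cases hl : l = []
    · subst hl
      exact ⟨[a], by simp, ⟨h1, h2⟩, by simp, by simp⟩
    obtain ⟨m, hm, hmw, hnd, hsub⟩ := ih _ h2 hl
    by_cases ha : a ∈ m
    · obtain ⟨A, B, rfl⟩ := List.append_of_mem ha
      obtain ⟨w, _, _, hB⟩ := (walkAux_append ..).1 hmw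
      refine ⟨a :: B, by simp, ⟨h1, hB⟩, (List.nodup_append.1 hnd).2.1, ?_⟩
      intro x hx
      simp only [List.mem_cons] at hx ⊢
      rcases hx with hx | hx
      · exact Or.inl hx
      · exact Or.inr (hsub x (by simp [hx]))
    · refine ⟨a :: m, by simp, ⟨h1, hmw⟩, by simp [ha, hnd], ?_⟩
      intro x hx
      simp only [List.mem_cons] at hx ⊢
      rcases hx with hx | hx
      · exact Or.inl hx
      · exact Or.inr (hsub x hx)

/-- One uncrossing step: path `p` can be replaced by a single arc `e` with the same ends. -/
theorem uncross {V β ι : Type*} (tl hd : β → V) (S T : ι → V) (Q : ι → List β)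
    (hQ : ∀ p, Q p ≠ [] ∧ WalkAux tl hd (S p) (T p) (Q p))
    (hnd : ∀ p, (Q p).Nodup) (hdis : ∀ p q, p ≠ q → ∀ a, a ∈ Q p → a ∉ Q q)
    (p : ι) (e : β) (he1 : tl e = S p) (he2 : hd e = T p) :
    ∃ Q' : ι → List β, (∀ p, Q' p ≠ [] ∧ WalkAux tl hd (S p) (T p) (Q' p)) ∧
      (∀ p, (Q' p).Nodup) ∧ (∀ p q, p ≠ q → ∀ a, a ∈ Q' p → a ∉ Q' q) ∧
      Q' p = [e] ∧ ∀ q, q ≠ p → e ∉ Q q → Q' q = Q q := by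
  classical
  by_cases h : ∃ q, q ≠ p ∧ e ∈ Q q
  · obtain ⟨q, hqp, heq⟩ := h
    obtain ⟨A, B, hAB⟩ := List.append_of_mem heq
    have hw := (hQ q).2
    rw [hAB, walkAux_append] at hw
    obtain ⟨w, hA, hw1, hB⟩ := hw
    have hn := hnd q
    have hq0 := hdis p q (Ne.symm hqp)
    have hmid : ∀ a, a ∈ A ++ (Q p ++ B) ↔ (a ∈ Q p ∨ (a ∈ Q q ∧ a ≠ e)) := by
      intro a
      rw [hAB] at hn ⊢
      simp only [List.mem_append, List.mem_cons, List.nodup_append, List.nodup_cons] at hn ⊢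
      grind
    have hep : e ∉ Q p := hdis q p hqp e heq
    refine ⟨fun r => if r = p then [e] else if r = q then A ++ (Q p ++ B) else Q r,
      ?_, ?_, ?_, by simp, ?_⟩
    · intro r
      by_cases hr : r = p
      · subst hr; simp [WalkAux, he1, he2]
      by_cases hr' : r = q
      · subst hr'
        simp only [hr, if_false, if_true]
        refine ⟨by simp [(hQ p).1], ?_⟩
        rw [walkAux_append]
        refine ⟨w, hA, ?_⟩
        rw [walkAux_append]
        refine ⟨T p, ?_, he2 ▸ hB⟩
        rw [← hw1, he1]; exact (hQ p).2
      · simpa [hr, hr'] using hQ r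
    · intro r
      by_cases hr : r = p
      · subst hr; simp
      by_cases hr' : r = q
      · subst hr'
        simp only [hr, if_false, if_true]
        have := hnd p
        rw [hAB] at hn hq0
        simp only [List.nodup_append, List.mem_append, List.nodup_cons, List.mem_cons] at hn hq0 ⊢
        grind
      · simpa [hr, hr'] using hnd r
    · intro r r' hne a
      have key : ∀ r, (a ∈ (if r = p then [e] else if r = q then A ++ (Q p ++ B) else Q r)) ↔
          (if r = p then a = e else if r = q then (a ∈ Q p ∨ (a ∈ Q q ∧ a ≠ e)) else a ∈ Q r) := by
        intro r
        split_ifs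
        · simp
        · exact hmid a
        · rfl
      simp only [key]
      have d1 := hdis r r' hne a
      have d2 := hdis p r
      have d3 := hdis p r'
      have d4 := hdis q r
      have d5 := hdis q r'
      grind
    · intro r hr her
      have : r ≠ q := by rintro rfl; exact her heq
      simp [hr, this]
  · push Not at h
    refine ⟨fun r => if r = p then [e] else Q r, ?_, ?_, ?_, by simp, ?_⟩
    · intro r
      by_cases hr : r = p
      · subst hr; simp [WalkAux, he1, he2]
      · simpa [hr] using hQ r
    · intro r
      by_cases hr : r = p
      · subst hr; simp
      · simpa [hr] using hnd r
    · intro r r' hne a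
      have d1 := hdis r r' hne a
      have d2 := h r
      have d3 := h r'
      grind
    · intro r hr _
      simp [hr]

theorem uncross_all {V β ι κ : Type*} [Fintype κ] (tl hd : β → V) (S T : ι → V)
    (g : κ → ι) (hg : Function.Injective g) (f : κ → β) (hf : Function.Injective f)
    (h1 : ∀ c, tl (f c) = S (g c)) (h2 : ∀ c, hd (f c) = T (g c)) (Q : ι → List β)
    (hQ : ∀ p, Q p ≠ [] ∧ WalkAux tl hd (S p) (T p) (Q p))
    (hnd : ∀ p, (Q p).Nodup) (hdis : ∀ p q, p ≠ q → ∀ a, a ∈ Q p → a ∉ Q q) :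
    ∃ Q' : ι → List β, (∀ p, Q' p ≠ [] ∧ WalkAux tl hd (S p) (T p) (Q' p)) ∧
      (∀ p, (Q' p).Nodup) ∧ (∀ p q, p ≠ q → ∀ a, a ∈ Q' p → a ∉ Q' q) ∧
      ∀ c, Q' (g c) = [f c] := by
  classical
  suffices H : ∀ F : Finset κ, ∃ Q' : ι → List β,
      (∀ p, Q' p ≠ [] ∧ WalkAux tl hd (S p) (T p) (Q' p)) ∧
      (∀ p, (Q' p).Nodup) ∧ (∀ p q, p ≠ q → ∀ a, a ∈ Q' p → a ∉ Q' q) ∧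
      ∀ c ∈ F, Q' (g c) = [f c] by
    simpa using H Finset.univ
  intro F
  induction F using Finset.induction_on with
  | empty => exact ⟨Q, hQ, hnd, hdis, by simp⟩
  | insert c F hc ih =>
    obtain ⟨Q1, a1, a2, a3, a4⟩ := ih
    obtain ⟨Q2, b1, b2, b3, b4, b5⟩ := uncross tl hd S T Q1 a1 a2 a3 (g c) (f c) (h1 c) (h2 c)
    refine ⟨Q2, b1, b2, b3, ?_⟩
    intro d hdm
    rcases Finset.mem_insert.1 hdm with rfl | hdF
    · exact b4
    · have hne : d ≠ c := by rintro rfl; exact hc hdF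
      rw [b5 (g d) (fun h => hne (hg h)), a4 d hdF]
      rw [a4 d hdF]
      simp only [List.mem_singleton]
      exact fun h => hne (hf h).symm

theorem exists_map_inl {α γ : Type*} (l : List (α ⊕ γ)) (h : ∀ c, Sum.inr c ∉ l) :
    ∃ m : List α, l = m.map Sum.inl := by
  induction l with
  | nil => exact ⟨[], rfl⟩
  | cons a l ih =>
    obtain ⟨m, rfl⟩ := ih (fun c hc => h c (List.mem_cons_of_mem _ hc))
    cases a with
    | inl a => exact ⟨a :: m, rfl⟩
    | inr c => exact absurd List.mem_cons_self (h c)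


theorem lawful_sum {α γ : Type*} [BEq α] [BEq γ] [LawfulBEq α] [LawfulBEq γ] : LawfulBEq (α ⊕ γ) where
  eq_of_beq {a b} h := by
    cases a <;> cases b <;> first | cases h | exact congrArg _ (eq_of_beq h)
  rfl {a} := by
    cases a with
    | inl a => exact beq_self_eq_true a
    | inr a => exact beq_self_eq_true a

/-- Hardness reduction: given a digraph D (arc type α) and pairs (sⁱ, tⁱ),
add a direct arc (sⁱ, tʲ) for every i ≠ j, give every arc capacity 1, and set
b(sⁱ) = k, b(tⁱ) = -k.  The resulting instance admits a feasible unsplittable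
transshipment (at most one path with a nonnegative value for each source-sink
pair, supplies and demands met exactly, at most one unit of flow per arc) if and
only if D contains pairwise arc-disjoint sⁱ–tⁱ paths for i = 1,…,k. -/
theorem stmt_18 {V α : Type*} [Fintype V] [Fintype α] [DecidableEq V] [DecidableEq α]
    (tl hd : α → V) (k : ℕ) (hk : 1 ≤ k) (s t : Fin k → V)
    (hs : Function.Injective s) (ht : Function.Injective t)
    (hst : ∀ i j, s i ≠ t j) :
    -- the extended arc set: original arcs of D plus the added arcs (sⁱ, tʲ), i ≠ j
    letI β := α ⊕ {p : Fin k × Fin k // p.1 ≠ p.2}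
    letI tl' : β → V := Sum.elim tl (fun p => s p.1.1)
    letI hd' : β → V := Sum.elim hd (fun p => t p.1.2)
    -- feasible unsplittable transshipment for the constructed instance
    ((∃ (Q : Fin k → Fin k → List β) (y : Fin k → Fin k → ℝ),
        (∀ i j, 0 ≤ y i j) ∧
        (∀ i j, 0 < y i j → DiPath tl' hd' (s i) (t j) (Q i j)) ∧
        (∀ i, ∑ j, y i j = (k : ℝ)) ∧
        (∀ j, ∑ i, y i j = (k : ℝ)) ∧
        (∀ e : β, ∑ i, ∑ j, y i j * ((Q i j).count e : ℝ) ≤ 1))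
      ↔
    -- pairwise arc-disjoint sⁱ–tⁱ paths in D
      (∃ P : Fin k → List α,
        (∀ i, DiPath tl hd (s i) (t i) (P i)) ∧
        (∀ i j, i ≠ j → ∀ a : α, a ∈ P i → a ∉ P j))) := by
  classical
  haveI : LawfulBEq (α ⊕ {p : Fin k × Fin k // p.1 ≠ p.2}) := lawful_sum
  let tl' : (α ⊕ {p : Fin k × Fin k // p.1 ≠ p.2}) → V := Sum.elim tl (fun p => s p.1.1)
  let hd' : (α ⊕ {p : Fin k × Fin k // p.1 ≠ p.2}) → V := Sum.elim hd (fun p => t p.1.2)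
  constructor
  · rintro ⟨Q, y, hy0, hQ, hrow, -, hcap⟩
    have hle : ∀ i j, y i j ≤ 1 := by
      intro i j
      rcases (hy0 i j).eq_or_lt with h | h
      · rw [← h]; exact zero_le_one
      · obtain ⟨hne, -⟩ := hQ i j h
        have hmem := List.head_mem hne
        set e := (Q i j).head hne
        have hc : 1 ≤ (Q i j).count e := List.one_le_count_iff.2 hmem
        have hc' : (1 : ℝ) ≤ ((Q i j).count e : ℝ) := by exact_mod_cast hc
        have hnn : ∀ a b, 0 ≤ y a b * ((Q a b).count e : ℝ) :=
          fun a b => mul_nonneg (hy0 a b) (Nat.cast_nonneg _)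
        calc y i j ≤ y i j * ((Q i j).count e : ℝ) := le_mul_of_one_le_right (hy0 i j) hc'
          _ ≤ ∑ b, y i b * ((Q i b).count e : ℝ) :=
            Finset.single_le_sum (f := fun b => y i b * ((Q i b).count e : ℝ))
              (fun b _ => hnn i b) (Finset.mem_univ j)
          _ ≤ ∑ a, ∑ b, y a b * ((Q a b).count e : ℝ) :=
            Finset.single_le_sum (f := fun a => ∑ b, y a b * ((Q a b).count e : ℝ))
              (fun a _ => Finset.sum_nonneg (fun b _ => hnn a b)) (Finset.mem_univ i)
          _ ≤ 1 := hcap e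
    have h1 : ∀ i j, y i j = 1 := by
      intro i j
      have := (Finset.sum_eq_sum_iff_of_le (s := Finset.univ) (f := y i) (g := fun _ => (1 : ℝ))
        (fun j _ => hle i j)).1 (by rw [hrow i]; simp)
      exact this j (Finset.mem_univ j)
    have hcap' : ∀ e : (α ⊕ {p : Fin k × Fin k // p.1 ≠ p.2}), ∑ p : Fin k × Fin k, (Q p.1 p.2).count e ≤ 1 := by
      intro e
      have h := hcap e
      simp only [h1, one_mul] at h
      rw [Fintype.sum_prod_type]
      exact_mod_cast h
    obtain ⟨Q', a1, a2, a3, a4⟩ := uncross_all (ι := Fin k × Fin k)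
      (κ := {p : Fin k × Fin k // p.1 ≠ p.2}) tl' hd' (fun p => s p.1) (fun p => t p.2)
      Subtype.val Subtype.val_injective (fun c => (Sum.inr c : (α ⊕ {p : Fin k × Fin k // p.1 ≠ p.2}))) Sum.inr_injective
      (fun c => rfl) (fun c => rfl) (fun p => Q p.1 p.2)
      (fun p => (diPath_iff ..).1 (hQ p.1 p.2 (by rw [h1]; exact one_pos)))
      (fun p => List.nodup_iff_count_le_one.2 (fun e =>
        (Finset.single_le_sum (f := fun p : Fin k × Fin k => (Q p.1 p.2).count e)
          (fun _ _ => Nat.zero_le _) (Finset.mem_univ p)).trans (hcap' e)))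
      (by
        intro p q hpq e hp hq
        have h := Finset.sum_le_sum_of_subset (f := fun p : Fin k × Fin k => (Q p.1 p.2).count e)
          (Finset.subset_univ {p, q})
        rw [Finset.sum_pair hpq] at h
        have := hcap' e
        have h2 : 1 ≤ (Q p.1 p.2).count e := List.one_le_count_iff.2 hp
        have h3 : 1 ≤ (Q q.1 q.2).count e := List.one_le_count_iff.2 hq
        omega)
    have hex : ∀ i, ∃ m : List α, Q' (i, i) = m.map Sum.inl := by
      intro i
      apply exists_map_inl
      intro c hc
      refine a3 (i, i) c.1 ?_ _ hc ?_
      · intro h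
        apply c.2
        rw [← h]
      · rw [a4 c]; simp
    choose P hP using hex
    refine ⟨P, ?_, ?_⟩
    · intro i
      have h := a1 (i, i)
      rw [hP i] at h
      rw [diPath_iff]
      refine ⟨by simpa using h.1, ?_⟩
      exact (walkAux_map tl hd tl' hd' Sum.inl (fun _ => rfl) (fun _ => rfl) _ _ _).1 h.2
    · intro i j hij a hi hj
      refine a3 (i, i) (j, j) (by simpa using hij) (Sum.inl a) ?_ ?_
      · rw [hP]; exact List.mem_map_of_mem hi
      · rw [hP]; exact List.mem_map_of_mem hj
  · rintro ⟨P, hP, hdis⟩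
    have hex := fun i => exists_nodup_walk tl hd (t i) (P i) (s i)
      ((diPath_iff ..).1 (hP i)).2 ((diPath_iff ..).1 (hP i)).1
    choose M hM0 hMw hMn hMs using hex
    let Q : Fin k → Fin k → List (α ⊕ {p : Fin k × Fin k // p.1 ≠ p.2}) := fun i j =>
      if h : i = j then (M i).map Sum.inl else [Sum.inr ⟨(i, j), h⟩]
    have hnd : ∀ i j, (Q i j).Nodup := by
      intro i j
      by_cases h : i = j
      · simp only [Q, h, dif_pos]
        exact (hMn j).map Sum.inl_injective
      · simp [Q, h]
    have hd2 : ∀ (e : (α ⊕ {p : Fin k × Fin k // p.1 ≠ p.2})) (p q : Fin k × Fin k), e ∈ Q p.1 p.2 → e ∈ Q q.1 q.2 → p = q := by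
      rintro e ⟨i, j⟩ ⟨i', j'⟩ h h'
      by_cases hij : i = j <;> by_cases hij' : i' = j'
      · subst hij hij'
        simp only [Q, dif_pos, List.mem_map] at h h'
        obtain ⟨a, ha, rfl⟩ := h
        obtain ⟨b, hb, hab⟩ := h'
        obtain rfl := Sum.inl_injective hab
        by_contra hne
        exact hdis i i' (fun h => hne (by rw [h])) _ (hMs _ _ ha) (hMs _ _ hb)
      · simp only [Q, hij, hij', dif_pos, dif_neg, not_false_eq_true, List.mem_map,
          List.mem_singleton] at h h'
        obtain ⟨a, ha, rfl⟩ := h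
        cases h'
      · simp only [Q, hij, hij', dif_pos, dif_neg, not_false_eq_true, List.mem_map,
          List.mem_singleton] at h h'
        obtain ⟨a, ha, rfl⟩ := h'
        cases h
      · simp only [Q, hij, hij', dif_neg, not_false_eq_true, List.mem_singleton] at h h'
        rw [h] at h'
        exact congrArg Subtype.val (Sum.inr_injective h')
    refine ⟨Q, fun _ _ => 1, fun _ _ => zero_le_one, ?_, by simp, by simp, ?_⟩
    · intro i j _
      rw [diPath_iff]
      by_cases h : i = j
      · subst h
        simp only [Q, dif_pos]
        exact ⟨by simpa using hM0 i, (walkAux_map tl hd tl' hd' Sum.inl (fun _ => rfl)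
          (fun _ => rfl) _ _ _).2 (hMw i)⟩
      · simp only [Q, h, dif_neg, not_false_eq_true]
        exact ⟨by simp, rfl, rfl⟩
    · intro e
      simp only [one_mul]
      have key : ∑ p : Fin k × Fin k, (Q p.1 p.2).count e ≤ 1 := by
        by_cases h : ∃ p : Fin k × Fin k, e ∈ Q p.1 p.2
        · obtain ⟨p, hp⟩ := h
          rw [Finset.sum_eq_single p]
          · exact List.nodup_iff_count_le_one.1 (hnd _ _) e
          · intro q _ hq
            exact List.count_eq_zero.2 (fun h => hq (hd2 e q p h hp))
          · simp
        · push Not at h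
          rw [Finset.sum_eq_zero (fun p _ => List.count_eq_zero.2 (h p))]
          exact zero_le_one
      rw [Fintype.sum_prod_type] at key
      exact_mod_cast key
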